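/- arXiv:1303.0969 — 2 statements merged into one kernel-verified Lean document; each statement's English description precedes it below -/
import Mathlib

section
/- Let α = [0; a_1, a_2, …] ∈ (0,1) be irrational and let c_α = u_{α,1−α} be the characteristic Sturmian word of slope α. If α < 1/2 (i.e., a_1 ≥ 2), then APR_{c_α} = {0, 01, 1} ∪ {1^j 0 : 1 ≤ j ≤ a_1}. If α > 1/2 (i.e., a_1 = 1), then APR_{c_α} = {1, 10, 0} ∪ {0^j 1 : 1 ≤ j ≤ a_2 + 1}. Here 1^j 0 denotes the word of j letters 1 followed by one letter 0, and 0^j 1 the word of j letters 0 followed by one letter 1. -/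
open Set

noncomputable section

/-- Exchange of two intervals with parameter `α`, acting on `[0,1)`:
`T_α(x) = x + 1 - α` for `x ∈ [0,α)` and `T_α(x) = x - α` for `x ∈ [α,1)`. -/
def twoIE (α x : ℝ) : ℝ := if x < α then x + 1 - α else x - α

/-- The Sturmian word with slope `α` and intercept `ρ`:
`false` codes the letter 0 (i.e. `T_α^n(ρ) ∈ [0,α)`), `true` codes the letter 1. -/
def sturmian (α ρ : ℝ) (n : ℕ) : Bool := if α ≤ (twoIE α)^[n] ρ then true else false

/-- The factor of length `n` of an infinite word `u` starting at position `i`. -/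
def seg (u : ℕ → Bool) (i n : ℕ) : List Bool := (List.range n).map (fun j => u (i + j))

/-- The prefix of length `n` of `u`. -/
def wordPrefix (u : ℕ → Bool) (n : ℕ) : List Bool := seg u 0 n

/-- Return time of `x` to the set `I` under `twoIE α`:
the least `m ≥ 1` such that `T_α^m(x) ∈ I`. -/
def returnTime (α : ℝ) (I : Set ℝ) (x : ℝ) : ℕ :=
  sInf {m : ℕ | 0 < m ∧ (twoIE α)^[m] x ∈ I}

/-- The `I`-itinerary of `x`: the prefix of length `returnTime α I x` of the
Sturmian word with slope `α` and intercept `x`. -/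
def itin (α : ℝ) (I : Set ℝ) (x : ℝ) : List Bool :=
  wordPrefix (sturmian α x) (returnTime α I x)

/-- Two binary words are abelian equivalent if they have the same length and the
same number of occurrences of the letter 0 (coded by `false`). -/
def AbEquiv (w w' : List Bool) : Prop :=
  w.length = w'.length ∧ w.count false = w'.count false

/-- `w` is a factor of the infinite word `u`. -/
def IsFactor (u : ℕ → Bool) (w : List Bool) : Prop := ∃ i, seg u i w.length = w

/-- Positions of occurrences in `u` of factors abelian equivalent to `w`. -/
def abOcc (u : ℕ → Bool) (w : List Bool) : Set ℕ :=
  {i | AbEquiv (seg u i w.length) w}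

/-- The set of abelian return words to `w` in `u`: the words of `u` lying between
two consecutive occurrences of factors abelian equivalent to `w`. -/
def AR (u : ℕ → Bool) (w : List Bool) : Set (List Bool) :=
  {v | ∃ i j : ℕ, i ∈ abOcc u w ∧ j ∈ abOcc u w ∧ i < j ∧
        (∀ m, i < m → m < j → m ∉ abOcc u w) ∧ v = seg u i (j - i)}

/-- The set of abelian return words to all nonempty prefixes of `u`. -/
def APR (u : ℕ → Bool) : Set (List Bool) :=
  ⋃ n ∈ {n : ℕ | 1 ≤ n}, AR u (wordPrefix u n)

/-- `S_β`: the set of `[0,β)`-itineraries under `twoIE α`. -/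
def Sitin (α β : ℝ) : Set (List Bool) :=
  {w | ∃ x ∈ Ico (0:ℝ) β, itin α (Ico (0:ℝ) β) x = w}

/-- `R^α_ρ`: the union of the sets of `[0,β)`-itineraries over `ρ ≤ β < 1`. -/
def Rlight (α ρ : ℝ) : Set (List Bool) := ⋃ β ∈ Ico ρ 1, Sitin α β

/-- `R'^α_ρ`: the union of the sets of `[γ,1)`-itineraries over `0 < γ ≤ ρ`. -/
def Rheavy (α ρ : ℝ) : Set (List Bool) :=
  ⋃ γ ∈ Ioc (0:ℝ) ρ, {w | ∃ x ∈ Ico γ 1, itin α (Ico γ 1) x = w}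

/-- The Gauss map `x ↦ {1/x}`. -/
def gaussMap (x : ℝ) : ℝ := Int.fract x⁻¹

/-- The `k`-th partial quotient `a_k` (for `k ≥ 1`) of the continued fraction
expansion `α = [0; a_1, a_2, …]` of `α ∈ (0,1)`. -/
def cfa (α : ℝ) (k : ℕ) : ℕ := ⌊(gaussMap^[k - 1] α)⁻¹⌋₊

/-- `cfPQ α n = (p_{n-1}, q_{n-1})`, numerators and denominators of the convergents
of `α`: `p_{-1} = 1`, `q_{-1} = 0`, `p_0 = 0`, `q_0 = 1`,
`p_k = a_k p_{k-1} + p_{k-2}`, `q_k = a_k q_{k-1} + q_{k-2}`. -/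
def cfPQ (α : ℝ) : ℕ → ℤ × ℤ
  | 0 => (1, 0)
  | 1 => (0, 1)
  | (k + 2) => ((cfa α (k + 1) : ℤ) * (cfPQ α (k + 1)).1 + (cfPQ α k).1,
                (cfa α (k + 1) : ℤ) * (cfPQ α (k + 1)).2 + (cfPQ α k).2)

/-- `δ_{k,s} = |(s-1)(p_k - α q_k) + p_{k-1} - α q_{k-1}|` for `k ≥ 0`, `1 ≤ s ≤ a_{k+1}`. -/
def cfDelta (α : ℝ) (k s : ℕ) : ℝ :=
  |((s : ℝ) - 1) * (((cfPQ α (k + 1)).1 : ℝ) - α * ((cfPQ α (k + 1)).2 : ℝ)) +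
      (((cfPQ α k).1 : ℝ) - α * ((cfPQ α k).2 : ℝ))|

end

theorem exists_fract_nat_mul_mem_Ioo {α a b : ℝ} (hirr : Irrational α) (ha : 0 ≤ a)
    (hab : a < b) (hb : b ≤ 1) : ∃ n : ℕ, 1 ≤ n ∧ Int.fract (n * α) ∈ Set.Ioo a b := by
  have hd : DenseRange (· • (α : AddCircle (1 : ℝ)) : ℕ → AddCircle (1 : ℝ)) :=
    denseRange_zsmul_iff_nsmul.1 (AddCircle.denseRange_zsmul_coe_iff.2 (by simpa using hirr))
  obtain ⟨n, t, ht, hn⟩ := hd.exists_mem_open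
    (QuotientAddGroup.isOpenMap_coe (N := AddSubgroup.zmultiples (1 : ℝ)) _ isOpen_Ioo)
    ((Set.nonempty_Ioo.2 hab).image _)
  have hfr : Int.fract (n * α) = t := by
    have h : ((Int.fract (n * α) : ℝ) : AddCircle (1 : ℝ)) = (t : AddCircle (1 : ℝ)) := by
      rw [AddCircle.coe_fract]
      have h2 : (t : AddCircle (1 : ℝ)) = n • (α : AddCircle (1 : ℝ)) := hn
      rw [h2, ← AddCircle.coe_nsmul, nsmul_eq_mul]
    exact (AddCircle.coe_eq_coe_iff_of_mem_Ico (a := (0 : ℝ)) (hp := ⟨one_pos⟩)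
      (by simp [Int.fract_lt_one])
      (by simpa using ⟨ha.trans ht.1.le, ht.2.trans_le hb⟩)).1 h
  refine ⟨n, Nat.one_le_iff_ne_zero.2 ?_, hfr ▸ ht⟩
  rintro rfl
  simp at hfr
  linarith [ht.1]

theorem length_seg (u : ℕ → Bool) (i n : ℕ) : (seg u i n).length = n := by simp [seg]

theorem seg_succ (u : ℕ → Bool) (i n : ℕ) : seg u i (n + 1) = seg u i n ++ [u (i + n)] := by
  simp [seg, List.range_succ]

theorem seg_eq_replicate {u : ℕ → Bool} {i n : ℕ} {b : Bool} (h : ∀ t < n, u (i + t) = b) :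
    seg u i n = List.replicate n b := by
  rw [List.eq_replicate_iff]
  refine ⟨length_seg u i n, fun c hc => ?_⟩
  obtain ⟨t, ht, rfl⟩ := List.mem_map.1 hc
  exact h t (List.mem_range.1 ht)

/-- Words `v` read off an orbit `y` of the rotation of `(0,1)` by `s`, the letter `b` coding the
steps that do not wrap around. -/
structure RotationCoding (y : ℕ → ℝ) (s : ℝ) (v : ℕ → Bool) (b : Bool) : Prop where
  pos : ∀ i, 0 < y i
  lt_one : ∀ i, y i < 1
  step : ∀ i, y i + s < 1 → y (i + 1) = y i + s ∧ v i = b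
  wrap : ∀ i, 1 ≤ y i + s → y (i + 1) = y i + s - 1 ∧ v i = !b

namespace RotationCoding

variable {y : ℕ → ℝ} {s : ℝ} {v : ℕ → Bool} {b : Bool}

theorem apply_add (h : RotationCoding y s v b) (hs : 0 < s) {i k : ℕ} (hk : y i + k * s < 1) :
    y (i + k) = y i + k * s := by
  induction k with
  | zero => simp
  | succ k ih =>
    push_cast at hk ⊢
    have := ih (by linarith)
    rw [← add_assoc, (h.step (i + k) (by rw [this]; linarith)).1, this]
    ring

theorem seg_eq (h : RotationCoding y s v b) (hs : 0 < s) {i k : ℕ} (hk : y i + k * s < 1)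
    (hk' : 1 ≤ y i + (k + 1) * s) :
    y (i + k + 1) = y i + (k + 1) * s - 1 ∧
      seg v i (k + 1) = List.replicate k b ++ [!b] := by
  have hy := h.apply_add hs hk
  have hw := h.wrap (i + k) (by rw [hy]; linarith)
  refine ⟨by rw [hw.1, hy]; ring, ?_⟩
  rw [seg_succ, hw.2, seg_eq_replicate]
  intro t ht
  have ht' : (t : ℝ) + 1 ≤ k := by exact_mod_cast ht
  have hle : y i + (t + 1) * s < 1 := by nlinarith
  refine (h.step (i + t) ?_).2
  rw [h.apply_add hs (by linarith)]
  linarith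

theorem exists_steps (h : RotationCoding y s v b) (hs : 0 < s) (i : ℕ) :
    ∃ k : ℕ, y i + k * s < 1 ∧ 1 ≤ y i + (k + 1) * s := by
  have hex : ∃ m : ℕ, 1 ≤ y i + (m + 1) * s := by
    obtain ⟨m, hm⟩ := exists_nat_ge (1 / s)
    refine ⟨m, ?_⟩
    rw [div_le_iff₀ hs] at hm
    linarith [h.pos i]
  refine ⟨Nat.find hex, ?_, Nat.find_spec hex⟩
  rcases hm : Nat.find hex with _ | m
  · simpa using h.lt_one i
  · have := Nat.find_min hex (m := m) (by omega)
    push_cast at this ⊢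
    linarith

/-- Words between consecutive visits of the orbit to `(0,β)`, for `β` larger than the step. -/
theorem return_word (h : RotationCoding y s v b) (hs : 0 < s) {β : ℝ} (hβ : s < β)
    {i j : ℕ} (hj : y j < β) (hij : i < j)
    (hm : ∀ m, i < m → m < j → ¬ y m < β) :
    seg v i (j - i) = [b] ∨
      ∃ k : ℕ, k * s < 1 ∧ seg v i (j - i) = List.replicate k b ++ [!b] := by
  by_cases h1 : y (i + 1) < β ∧ y i + s < 1
  · have hji : j = i + 1 := by
      by_contra hne
      exact hm (i + 1) (by omega) (by omega) h1.1
    left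
    subst hji
    simp [seg, (h.step i h1.2).2]
  · obtain ⟨k, hk, hk'⟩ := h.exists_steps hs i
    obtain ⟨hy, hseg⟩ := h.seg_eq hs hk hk'
    right
    refine ⟨k, by linarith [h.pos i], ?_⟩
    have hle : j ≤ i + k + 1 := by
      by_contra hlt
      exact hm (i + k + 1) (by omega) (by omega) (by rw [hy]; linarith)
    have hge : i + k + 1 ≤ j := by
      by_contra hlt
      obtain ⟨t, rfl⟩ : ∃ t, j = i + (t + 1) := ⟨j - i - 1, by omega⟩
      have htk : ((t + 1 : ℕ) : ℝ) ≤ k := by exact_mod_cast (by omega : t + 1 ≤ k)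
      have hys : y i + ((t + 1 : ℕ) : ℝ) * s < 1 := by nlinarith
      have hyt := h.apply_add hs hys
      push_cast at hyt hys
      have hts : 0 ≤ (t : ℝ) * s := by positivity
      have hlt1 : y i + s < 1 := by linarith
      refine h1 ⟨?_, hlt1⟩
      rw [(h.step i hlt1).1]
      linarith
    rw [← hseg, show j - i = k + 1 by omega]

theorem not_visit (h : RotationCoding y s v b) (hs : 0 < s) {β : ℝ} {i k : ℕ}
    (hk : y i + k * s < 1) (hβ : β ≤ y i + s) {m : ℕ} (him : i < m) (hmk : m < i + k + 1) :
    ¬ y m < β := by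
  obtain ⟨t, rfl⟩ : ∃ t, m = i + (t + 1) := ⟨m - i - 1, by omega⟩
  have htk : ((t + 1 : ℕ) : ℝ) ≤ k := by exact_mod_cast (by omega : t + 1 ≤ k)
  have hyt := h.apply_add hs (i := i) (k := t + 1) (by nlinarith)
  push_cast at hyt
  have hts : 0 ≤ (t : ℝ) * s := by positivity
  rw [hyt]
  linarith

/-- Every word of the form `b ^ k (!b)` with `k * s < 1` separates two consecutive visits to
`(0,β)`, for all `β` in a suitable interval above the step. -/
theorem exists_return_word (h : RotationCoding y s v b) (hs : 0 < s) (hs1 : s < 1)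
    (hd : ∀ a c : ℝ, 0 ≤ a → a < c → c ≤ 1 → ∃ i, y i ∈ Set.Ioo a c) {k : ℕ} (hk : k * s < 1) :
    ∃ i j : ℕ, ∃ lo hi : ℝ, 0 ≤ lo ∧ lo < hi ∧ hi ≤ 1 ∧ i < j ∧
      seg v i (j - i) = List.replicate k b ++ [!b] ∧
      ∀ β ∈ Set.Ioo lo hi, s < β ∧ y i < β ∧ y j < β ∧ ∀ m, i < m → m < j → ¬ y m < β := by
  have hks : 0 ≤ k * s := by positivity
  obtain ⟨i, hi1, hi2⟩ := hd (max 0 (1 - (k + 1) * s)) (1 - k * s) (le_max_left _ _)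
    (max_lt (by linarith) (by linarith)) (by linarith)
  have hi3 := (le_max_right _ _).trans_lt hi1
  obtain ⟨hy, hseg⟩ := h.seg_eq hs (i := i) (k := k) (by linarith) (by linarith)
  refine ⟨i, i + k + 1, max s (y i), min 1 (y i + s), hs.le.trans (le_max_left _ _), ?_,
    min_le_left _ _, by omega, ?_, ?_⟩
  · exact max_lt (lt_min hs1 (by linarith [h.pos i])) (lt_min (h.lt_one i) (by linarith))
  · rw [← hseg, show i + k + 1 - i = k + 1 by omega]
  · rintro β ⟨hβ1, hβ2⟩
    obtain ⟨h1, h2⟩ := max_lt_iff.1 hβ1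
    refine ⟨h1, h2, by rw [hy]; linarith, fun m him hmk => ?_⟩
    exact h.not_visit hs (by linarith) ((hβ2.le).trans (min_le_right _ _)) him hmk

end RotationCoding

theorem Irrational.nat_mul_ne_int {α : ℝ} (hirr : Irrational α) {n : ℕ} (hn : n ≠ 0) (z : ℤ) :
    n * α ≠ z :=
  (hirr.natCast_mul hn).ne_int z

/-- The orbit of the intercept of the characteristic Sturmian word of slope `α`. -/
theorem twoIE_iterate_eq {α : ℝ} (hα : α ∈ Set.Ioo (0 : ℝ) 1) (hirr : Irrational α) (i : ℕ) :
    (twoIE α)^[i] (1 - α) = 1 - Int.fract ((i + 1 : ℕ) * α) := by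
  obtain ⟨h0, h1⟩ := hα
  induction i with
  | zero => simp [Int.fract_eq_self.2 ⟨h0.le, h1⟩]
  | succ i ih =>
    rw [Function.iterate_succ_apply', ih]
    have hf0 := Int.fract_nonneg ((i + 1 : ℕ) * α)
    have hf1 := Int.fract_lt_one ((i + 1 : ℕ) * α)
    have hfl := Int.floor_add_fract ((i + 1 : ℕ) * α)
    generalize Int.fract ((i + 1 : ℕ) * α) = f at *
    generalize ⌊(i + 1 : ℕ) * α⌋ = z at *
    have hne := hirr.nat_mul_ne_int (n := i + 1 + 1) (by omega) (z + 1)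
    push_cast at hfl hne ⊢
    have hfa : f + α ≠ 1 := fun hc => hne (by linarith)
    unfold twoIE
    split_ifs with hlt
    · rw [(Int.fract_eq_iff (b := f + α - 1)).2
        ⟨by linarith, by linarith, z + 1, by push_cast; linarith⟩]
      ring
    · rw [(Int.fract_eq_iff (b := f + α)).2
        ⟨by linarith, lt_of_le_of_ne (by linarith) hfa, z, by linarith⟩]
      ring

section characteristic

variable {α : ℝ}

theorem twoIE_iterate_mem_Ioo (hα : α ∈ Set.Ioo (0 : ℝ) 1) (hirr : Irrational α) (i : ℕ) :
    (twoIE α)^[i] (1 - α) ∈ Set.Ioo (0 : ℝ) 1 := by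
  rw [twoIE_iterate_eq hα hirr]
  have h : Int.fract ((i + 1 : ℕ) * α) ≠ 0 := fun hc =>
    hirr.nat_mul_ne_int (Nat.succ_ne_zero i) ⌊(i + 1 : ℕ) * α⌋
      (by linarith [Int.floor_add_fract ((i + 1 : ℕ) * α)])
  have := lt_of_le_of_ne (Int.fract_nonneg ((i + 1 : ℕ) * α)) h.symm
  have := Int.fract_lt_one ((i + 1 : ℕ) * α)
  constructor <;> linarith

theorem twoIE_iterate_ne_fract (hα : α ∈ Set.Ioo (0 : ℝ) 1) (hirr : Irrational α) (i n : ℕ) :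
    (twoIE α)^[i] (1 - α) ≠ Int.fract (n * α) := by
  rw [twoIE_iterate_eq hα hirr]
  intro hc
  refine hirr.nat_mul_ne_int (n := n + (i + 1)) (by omega)
    (⌊n * α⌋ + ⌊(i + 1 : ℕ) * α⌋ + 1) ?_
  have h1 := Int.floor_add_fract (n * α)
  have h2 := Int.floor_add_fract ((i + 1 : ℕ) * α)
  push_cast at *
  linarith

theorem twoIE_iterate_succ_of_lt {i : ℕ} (h : (twoIE α)^[i] (1 - α) < α) :
    (twoIE α)^[i + 1] (1 - α) = (twoIE α)^[i] (1 - α) + 1 - α ∧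
      sturmian α (1 - α) i = false := by
  rw [Function.iterate_succ_apply', sturmian, if_neg (not_le.2 h)]
  simp [twoIE, h]

theorem twoIE_iterate_succ_of_le {i : ℕ} (h : α ≤ (twoIE α)^[i] (1 - α)) :
    (twoIE α)^[i + 1] (1 - α) = (twoIE α)^[i] (1 - α) - α ∧
      sturmian α (1 - α) i = true := by
  rw [Function.iterate_succ_apply', sturmian, if_pos h]
  simp [twoIE, not_lt.2 h]

theorem rotationCoding_light (hα : α ∈ Set.Ioo (0 : ℝ) 1) (hirr : Irrational α) :
    RotationCoding (fun i => (twoIE α)^[i] (1 - α)) (1 - α) (sturmian α (1 - α)) false where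
  pos i := (twoIE_iterate_mem_Ioo hα hirr i).1
  lt_one i := (twoIE_iterate_mem_Ioo hα hirr i).2
  step i h := by
    obtain ⟨h1, h2⟩ := twoIE_iterate_succ_of_lt (i := i) (α := α) (by linarith)
    exact ⟨by linarith, h2⟩
  wrap i h := by
    obtain ⟨h1, h2⟩ := twoIE_iterate_succ_of_le (i := i) (α := α) (by linarith)
    exact ⟨by linarith, h2⟩

theorem rotationCoding_heavy (hα : α ∈ Set.Ioo (0 : ℝ) 1) (hirr : Irrational α) :
    RotationCoding (fun i => 1 - (twoIE α)^[i] (1 - α)) α (sturmian α (1 - α)) true where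
  pos i := by linarith [(twoIE_iterate_mem_Ioo hα hirr i).2]
  lt_one i := by linarith [(twoIE_iterate_mem_Ioo hα hirr i).1]
  step i h := by
    obtain ⟨h1, h2⟩ := twoIE_iterate_succ_of_le (i := i) (α := α) (by linarith)
    exact ⟨by linarith, h2⟩
  wrap i h := by
    have hne : (twoIE α)^[i] (1 - α) ≠ α := by
      have := twoIE_iterate_ne_fract hα hirr i 1
      rwa [Nat.cast_one, one_mul, Int.fract_eq_self.2 ⟨hα.1.le, hα.2⟩] at this
    obtain ⟨h1, h2⟩ := twoIE_iterate_succ_of_lt (i := i) (α := α)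
      (lt_of_le_of_ne (by linarith) hne)
    exact ⟨by linarith, h2⟩

theorem count_false_seg (i n : ℕ) :
    ((seg (sturmian α (1 - α)) i n).count false : ℝ) =
      (twoIE α)^[i + n] (1 - α) - (twoIE α)^[i] (1 - α) + n * α := by
  induction n with
  | zero => simp [seg]
  | succ n ih =>
    rw [seg_succ, List.count_append, Nat.cast_add, ih, ← add_assoc]
    rcases lt_or_ge ((twoIE α)^[i + n] (1 - α)) α with h | h
    · obtain ⟨h1, h2⟩ := twoIE_iterate_succ_of_lt h
      rw [h1, h2]
      push_cast
      simp
      ring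
    · obtain ⟨h1, h2⟩ := twoIE_iterate_succ_of_le h
      rw [h1, h2]
      push_cast
      simp
      ring

/-- The number of zeros of a factor is governed by the position of the orbit relative to
`fract (n * α)`. -/
theorem count_false_seg_eq (hα : α ∈ Set.Ioo (0 : ℝ) 1) (hirr : Irrational α) (i n : ℕ) :
    ((seg (sturmian α (1 - α)) i n).count false : ℤ) =
      ⌊n * α⌋ + if (twoIE α)^[i] (1 - α) < Int.fract (n * α) then 1 else 0 := by
  have hc := count_false_seg (α := α) i n
  have hfl := Int.floor_add_fract (n * α)
  have hx := twoIE_iterate_mem_Ioo hα hirr i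
  have hx' := twoIE_iterate_mem_Ioo hα hirr (i + n)
  have hf0 := Int.fract_nonneg (n * α)
  have hf1 := Int.fract_lt_one (n * α)
  generalize (seg (sturmian α (1 - α)) i n).count false = c at *
  generalize (twoIE α)^[i] (1 - α) = x at *
  generalize (twoIE α)^[i + n] (1 - α) = x' at *
  generalize Int.fract (n * α) = f at *
  generalize ⌊n * α⌋ = z at *
  obtain ⟨hx0, hx1⟩ := hx
  obtain ⟨hx0', hx1'⟩ := hx'
  split_ifs with h
  · have h1 : ((z : ℤ) : ℝ) < ((c : ℤ) : ℝ) := by push_cast; linarith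
    have h2 : ((c : ℤ) : ℝ) < ((z + 2 : ℤ) : ℝ) := by push_cast; linarith
    have h1' := Int.cast_lt.1 h1
    have h2' := Int.cast_lt.1 h2
    omega
  · have h1 : ((z - 1 : ℤ) : ℝ) < ((c : ℤ) : ℝ) := by push_cast; linarith
    have h2 : ((c : ℤ) : ℝ) < ((z + 1 : ℤ) : ℝ) := by push_cast; linarith
    have h1' := Int.cast_lt.1 h1
    have h2' := Int.cast_lt.1 h2
    omega

theorem mem_abOcc_iff (hα : α ∈ Set.Ioo (0 : ℝ) 1) (hirr : Irrational α) (i n : ℕ) :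
    i ∈ abOcc (sturmian α (1 - α)) (wordPrefix (sturmian α (1 - α)) n) ↔
      ((twoIE α)^[i] (1 - α) < Int.fract (n * α) ↔ 1 - α < Int.fract (n * α)) := by
  have h1 := count_false_seg_eq hα hirr i n
  have h2 := count_false_seg_eq hα hirr 0 n
  rw [Function.iterate_zero_apply] at h2
  simp only [abOcc, AbEquiv, wordPrefix, Set.mem_ofPred_eq, length_seg, true_and]
  split_ifs at h1 h2 with ha hb hb <;> simp only [ha, hb] <;> simp <;> omega

theorem mem_abOcc_light (hα : α ∈ Set.Ioo (0 : ℝ) 1) (hirr : Irrational α) {n : ℕ}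
    (hn : 1 - α < Int.fract (n * α)) (i : ℕ) :
    i ∈ abOcc (sturmian α (1 - α)) (wordPrefix (sturmian α (1 - α)) n) ↔
      (twoIE α)^[i] (1 - α) < Int.fract (n * α) := by
  rw [mem_abOcc_iff hα hirr, iff_true_right hn]

theorem mem_abOcc_heavy (hα : α ∈ Set.Ioo (0 : ℝ) 1) (hirr : Irrational α) {n : ℕ}
    (hn : Int.fract (n * α) < 1 - α) (i : ℕ) :
    i ∈ abOcc (sturmian α (1 - α)) (wordPrefix (sturmian α (1 - α)) n) ↔
      1 - (twoIE α)^[i] (1 - α) < 1 - Int.fract (n * α) := by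
  rw [mem_abOcc_iff hα hirr, iff_false_right (not_lt.2 hn.le), not_lt, sub_lt_sub_iff_left]
  exact ⟨fun h => lt_of_le_of_ne h (twoIE_iterate_ne_fract hα hirr i n).symm, le_of_lt⟩

/-- The abelian return words to prefixes of the characteristic word, uniformly in the slope. -/
theorem mem_APR_iff (hα : α ∈ Set.Ioo (0 : ℝ) 1) (hirr : Irrational α) (w : List Bool) :
    w ∈ APR (sturmian α (1 - α)) ↔
      (∃ k : ℕ, k * α < 1 ∧ w = List.replicate k true ++ [false]) ∨
        ∃ k : ℕ, k * (1 - α) < 1 ∧ w = List.replicate k false ++ [true] := by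
  have hα0 := hα.1
  have hα1 := hα.2
  have hL := rotationCoding_light hα hirr
  have hH := rotationCoding_heavy hα hirr
  simp only [APR, AR, Set.mem_iUnion, Set.mem_ofPred_eq, wordPrefix]
  constructor
  · rintro ⟨n, hn, i, j, -, hj, hij, hm, rfl⟩
    have hne : 1 - α ≠ Int.fract (n * α) := twoIE_iterate_ne_fract hα hirr 0 n
    rcases lt_or_gt_of_ne hne with hlt | hlt
    · have hocc := mem_abOcc_light hα hirr hlt
      simp only [wordPrefix] at hocc
      simp only [hocc] at hj hm
      rcases hL.return_word (by linarith) hlt hj hij hm with h | ⟨k, hk, h⟩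
      · exact Or.inl ⟨0, by simp, by simpa using h⟩
      · exact Or.inr ⟨k, hk, h⟩
    · have hocc := mem_abOcc_heavy hα hirr hlt
      simp only [wordPrefix] at hocc
      simp only [hocc] at hj hm
      rcases hH.return_word hα0 (by linarith) hj hij hm with h | ⟨k, hk, h⟩
      · exact Or.inr ⟨0, by simp, by simpa using h⟩
      · exact Or.inl ⟨k, hk, h⟩
  · have hdH : ∀ a c : ℝ, 0 ≤ a → a < c → c ≤ 1 →
        ∃ i, 1 - (twoIE α)^[i] (1 - α) ∈ Set.Ioo a c := by
      intro a c ha hac hc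
      obtain ⟨n, hn, hmem⟩ := exists_fract_nat_mul_mem_Ioo hirr ha hac hc
      refine ⟨n - 1, ?_⟩
      rwa [twoIE_iterate_eq hα hirr, Nat.sub_add_cancel hn, sub_sub_cancel]
    rintro (⟨k, hk, rfl⟩ | ⟨k, hk, rfl⟩)
    · obtain ⟨i, j, lo, hi, hlo, hlohi, hhi, hij, hseg, hβ⟩ :=
        hH.exists_return_word hα0 hα1 hdH hk
      obtain ⟨n, hn, hn1, hn2⟩ := exists_fract_nat_mul_mem_Ioo hirr (a := 1 - hi) (b := 1 - lo)
        (by linarith) (by linarith) (by linarith)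
      obtain ⟨h1, h2, h3, h4⟩ := hβ (1 - Int.fract (n * α)) ⟨by linarith, by linarith⟩
      have hocc := mem_abOcc_heavy hα hirr (n := n) (by linarith)
      exact ⟨n, hn, i, j, (hocc i).2 h2, (hocc j).2 h3, hij,
        fun m him hmj hc => h4 m him hmj ((hocc m).1 hc), hseg.symm⟩
    · obtain ⟨i, j, lo, hi, hlo, hlohi, hhi, hij, hseg, hβ⟩ :=
        hL.exists_return_word (by linarith) (by linarith) (fun a c ha hac hc => by
          obtain ⟨i, hi1, hi2⟩ := hdH (1 - c) (1 - a) (by linarith) (by linarith) (by linarith)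
          exact ⟨i, by linarith, by linarith⟩) hk
      obtain ⟨n, hn, hmem⟩ := exists_fract_nat_mul_mem_Ioo hirr hlo hlohi hhi
      obtain ⟨h1, h2, h3, h4⟩ := hβ _ hmem
      have hocc := mem_abOcc_light hα hirr h1
      exact ⟨n, hn, i, j, (hocc i).2 h2, (hocc j).2 h3, hij,
        fun m him hmj hc => h4 m him hmj ((hocc m).1 hc), hseg.symm⟩

end characteristic

theorem Irrational.natCast_mul_lt_one_iff {s : ℝ} (hirr : Irrational s) (hs : 0 < s) (k : ℕ) :
    k * s < 1 ↔ k ≤ ⌊s⁻¹⌋₊ := by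
  rw [Nat.le_floor_iff (inv_nonneg.2 hs.le), ← one_div, le_div_iff₀ hs]
  refine ⟨le_of_lt, fun h => lt_of_le_of_ne h ?_⟩
  rcases eq_or_ne k 0 with rfl | hk
  · simp
  · exact_mod_cast hirr.nat_mul_ne_int hk 1

theorem floor_inv_eq_one {s : ℝ} (h : 1 / 2 < s) (h1 : s < 1) : ⌊s⁻¹⌋₊ = 1 := by
  have hs : 0 < s := by linarith
  rw [Nat.floor_eq_iff (inv_nonneg.2 hs.le), ← one_div, le_div_iff₀ hs, div_lt_iff₀ hs]
  push_cast
  constructor <;> linarith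

theorem Irrational.one_sub {α : ℝ} (hirr : Irrational α) : Irrational (1 - α) := by
  simpa using hirr.natCast_sub 1

/-- For `1 / 2 < α < 1` the first partial quotient of `1 - α` is `a₂ + 1`. -/
theorem cfa_two_add_one {α : ℝ} (h : 1 / 2 < α) (h1 : α < 1) :
    cfa α 2 + 1 = ⌊(1 - α)⁻¹⌋₊ := by
  have hα : 0 < α := by linarith
  have hfl : ⌊α⁻¹⌋ = 1 := by
    rw [← Int.natCast_floor_eq_floor (inv_nonneg.2 hα.le), floor_inv_eq_one h h1, Nat.cast_one]
  have hinv : (gaussMap α)⁻¹ + 1 = (1 - α)⁻¹ := by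
    have : 1 - α ≠ 0 := by linarith
    rw [gaussMap, Int.fract, hfl, Int.cast_one, show α⁻¹ - 1 = (1 - α) / α by field_simp]
    field_simp
    ring
  rw [← hinv, Nat.floor_add_one]
  · simp [cfa]
  · exact inv_nonneg.2 (Int.fract_nonneg _)

theorem exists_replicate_iff (b : Bool) (A : ℕ) (w : List Bool) :
    ((∃ k ≤ A, w = List.replicate k b ++ [!b]) ∨ ∃ k ≤ 1, w = List.replicate k (!b) ++ [b]) ↔
      w ∈ ({[!b], [!b, b], [b]} : Set (List Bool)) ∪
        {w | ∃ j : ℕ, 1 ≤ j ∧ j ≤ A ∧ w = List.replicate j b ++ [!b]} := by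
  constructor
  · rintro (⟨k, hk, rfl⟩ | ⟨k, hk, rfl⟩)
    · rcases Nat.eq_zero_or_pos k with rfl | hpos
      · simp
      · exact Or.inr ⟨k, hpos, hk, rfl⟩
    · interval_cases k <;> simp
  · rintro ((rfl | rfl | rfl) | ⟨k, -, hk, rfl⟩)
    · exact Or.inl ⟨0, by simp, by simp⟩
    · exact Or.inr ⟨1, by simp, by simp⟩
    · exact Or.inr ⟨0, by simp, by simp⟩
    · exact Or.inl ⟨k, hk, rfl⟩

/-- for the characteristic Sturmian word `c_α = u_{α,1-α}`:
if `α < 1/2` then `APR_{c_α} = {0, 01, 1} ∪ {1^j 0 : 1 ≤ j ≤ a₁}`;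
if `α > 1/2` then `APR_{c_α} = {1, 10, 0} ∪ {0^j 1 : 1 ≤ j ≤ a₂ + 1}`. -/
theorem APR_characteristic (α : ℝ) (hα : α ∈ Set.Ioo (0:ℝ) 1)
    (hirr : Irrational α) :
    (α < 1 / 2 →
      APR (sturmian α (1 - α)) =
        ({[false], [false, true], [true]} : Set (List Bool)) ∪
          {w | ∃ j : ℕ, 1 ≤ j ∧ j ≤ cfa α 1 ∧
            w = List.replicate j true ++ [false]}) ∧
    (1 / 2 < α →
      APR (sturmian α (1 - α)) =
        ({[true], [true, false], [false]} : Set (List Bool)) ∪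
          {w | ∃ j : ℕ, 1 ≤ j ∧ j ≤ cfa α 2 + 1 ∧
            w = List.replicate j false ++ [true]}) := by
  have h0 := hα.1
  have h1 := hα.2
  have hk (k : ℕ) := hirr.natCast_mul_lt_one_iff h0 k
  have hk' (k : ℕ) := hirr.one_sub.natCast_mul_lt_one_iff (sub_pos.2 h1) k
  constructor <;> intro h <;> ext w <;> rw [mem_APR_iff hα hirr] <;> simp only [hk, hk']
  · rw [floor_inv_eq_one (by linarith : 1 / 2 < 1 - α) (by linarith)]
    exact exists_replicate_iff true (cfa α 1) w
  · rw [floor_inv_eq_one h h1, ← cfa_two_add_one h h1, or_comm]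
    exact exists_replicate_iff false (cfa α 2 + 1) w
end

section
/- Let α = [0; a_1, a_2, …] ∈ (0,1) be irrational, and let δ̃ < δ be two consecutive elements of the set Δ = { δ_{k,s} : k ≥ 0, 1 ≤ s ≤ a_{k+1} } (i.e., δ̃, δ ∈ Δ and no element of Δ lies strictly between them). Suppose S_δ = {R, R'} with R ≺_lex R'. Then for every β with δ̃ < β < δ one has S_β = {R, R', RR'}, and moreover S_δ̃ equals either {R, RR'} or {R', RR'}. -/
open Set

lemma seg_add (u : ℕ → Bool) (i m n : ℕ) : seg u i (m + n) = seg u i m ++ seg u (i + m) n := by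
  simp [seg, List.range_add, Function.comp_def, add_assoc]

lemma seg_sturmian (α x : ℝ) (m n : ℕ) :
    seg (sturmian α x) m n = wordPrefix (sturmian α ((twoIE α)^[m] x)) n := by
  simp only [wordPrefix, seg, sturmian, zero_add, ← Function.iterate_add_apply]
  simp [add_comm]

/-- The orbit of `x` spells the nonempty word `w` on its way to `y`, and avoids `[0, d)`
strictly in between. -/
def Excursion (α d x : ℝ) (w : List Bool) (y : ℝ) : Prop :=
  0 < w.length ∧ wordPrefix (sturmian α x) w.length = w ∧ (twoIE α)^[w.length] x = y ∧
    ∀ m, 0 < m → m < w.length → (twoIE α)^[m] x ∉ Ico (0 : ℝ) d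

lemma Excursion.mono {α d e x y : ℝ} {w : List Bool} (h : Excursion α d x w y) (hed : e ≤ d) :
    Excursion α e x w y :=
  ⟨h.1, h.2.1, h.2.2.1, fun m h0 hm hmem => h.2.2.2 m h0 hm ⟨hmem.1, hmem.2.trans_le hed⟩⟩

lemma Excursion.append {α d x y z : ℝ} {w w' : List Bool} (h : Excursion α d x w y)
    (h' : Excursion α d y w' z) (hy : d ≤ y) : Excursion α d x (w ++ w') z := by
  obtain ⟨h0, hw, hxy, hm⟩ := h
  obtain ⟨h0', hw', hyz, hm'⟩ := h'
  refine ⟨by simp; omega, ?_, ?_, ?_⟩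
  · rw [List.length_append, wordPrefix, seg_add, zero_add,
      seg_sturmian α x w.length, hxy, hw']
    exact congrArg (· ++ w') hw
  · rw [List.length_append, add_comm, Function.iterate_add_apply, hxy, hyz]
  · intro m hm0 hml hmem
    rw [List.length_append] at hml
    rcases lt_trichotomy m w.length with h | h | h
    · exact hm m hm0 h hmem
    · rw [h, hxy] at hmem
      exact absurd hmem.2 hy.not_gt
    · obtain ⟨j, rfl⟩ := Nat.exists_eq_add_of_lt h
      rw [show w.length + j + 1 = (j + 1) + w.length by ring, Function.iterate_add_apply,
        hxy] at hmem
      exact hm' (j + 1) (by omega) (by omega) hmem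

lemma Excursion.itin_eq {α d x y : ℝ} {w : List Bool} (h : Excursion α d x w y)
    (hy : y ∈ Ico (0 : ℝ) d) : itin α (Ico (0 : ℝ) d) x = w := by
  obtain ⟨h0, hw, hxy, hm⟩ := h
  have hr : returnTime α (Ico (0 : ℝ) d) x = w.length := by
    refine IsLeast.csInf_eq ⟨⟨h0, hxy ▸ hy⟩, fun m hmem => ?_⟩
    by_contra! hlt
    exact hm m hmem.1 hlt hmem.2
  rw [itin, hr, hw]

/-- The map induced by `twoIE α` on `[0, a + b)` exchanges `[0, a)` and `[a, a + b)`, with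
itineraries `U` and `V`. -/
structure InducedExchange (α a b : ℝ) (U V : List Bool) : Prop where
  left : ∀ x, 0 ≤ x → x < a → Excursion α (a + b) x U (x + b)
  right : ∀ x, a ≤ x → x < a + b → Excursion α (a + b) x V (x - a)

lemma inducedExchange_initial {α : ℝ} : InducedExchange α α (1 - α) [false] [true] where
  left x _ hx := by
    refine ⟨by simp, ?_, ?_, ?_⟩
    · simp [wordPrefix, seg, sturmian, hx.not_ge]
    · simp [twoIE, hx]; ring
    · intro m h0 h1; simp at h1; omega
  right x hx _ := by
    refine ⟨by simp, ?_, ?_, ?_⟩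
    · simp [wordPrefix, seg, sturmian, hx]
    · simp [twoIE, hx.not_gt]
    · intro m h0 h1; simp at h1; omega

namespace InducedExchange

variable {α a b : ℝ} {U V : List Bool}

/-- A point of `[0, a)` sent by the induced map outside `[0, d)` returns to `[0, d)` after reading
`U ++ V`. -/
lemma left_right (h : InducedExchange α a b U V) {d x : ℝ} (ha : a ≤ d) (hd : d ≤ a + b)
    (hx0 : 0 ≤ x) (hx : d - b ≤ x) (hxa : x < a) :
    Excursion α d x (U ++ V) (x + b - a) :=
  ((h.left x hx0 hxa).mono hd).append
    ((h.right (x + b) (by linarith) (by linarith)).mono hd) (by linarith)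

lemma step_of_lt (h : InducedExchange α a b U V) (hb : 0 < b) (hab : b < a) :
    InducedExchange α (a - b) b U (U ++ V) where
  left x hx0 hx := by
    rw [sub_add_cancel]
    exact (h.left x hx0 (by linarith)).mono (by linarith)
  right x hx hxa := by
    rw [sub_add_cancel] at *
    rw [show x - (a - b) = x + b - a by ring]
    exact h.left_right le_rfl (by linarith) (by linarith) hx hxa

lemma step_of_gt (h : InducedExchange α a b U V) (ha : 0 < a) (hab : a < b) :
    InducedExchange α a (b - a) (U ++ V) V where
  left x hx0 hx := by
    rw [add_sub_cancel, ← add_sub_assoc]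
    exact h.left_right hab.le (by linarith) hx0 (by linarith) hx
  right x hx hxb := by
    rw [add_sub_cancel] at *
    exact (h.right x hx (by linarith)).mono (by linarith)

lemma Sitin_eq (h : InducedExchange α a b U V) (ha : 0 < a) (hb : 0 < b) :
    Sitin α (a + b) = {U, V} := by
  have hl : ∀ x, 0 ≤ x → x < a → itin α (Ico 0 (a + b)) x = U := fun x h0 hx =>
    (h.left x h0 hx).itin_eq ⟨by linarith, by linarith⟩
  have hr : ∀ x, a ≤ x → x < a + b → itin α (Ico 0 (a + b)) x = V := fun x h0 hx =>
    (h.right x h0 hx).itin_eq ⟨by linarith, by linarith⟩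
  ext w
  simp only [Sitin, mem_ofPred_eq, mem_Ico, mem_insert_iff, mem_singleton_iff]
  constructor
  · rintro ⟨x, ⟨hx0, hx⟩, rfl⟩
    rcases lt_or_ge x a with hxa | hxa
    · exact .inl (hl x hx0 hxa)
    · exact .inr (hr x hxa hx)
  · rintro (rfl | rfl)
    · exact ⟨0, ⟨le_rfl, by linarith⟩, hl 0 le_rfl ha⟩
    · exact ⟨a, ⟨ha.le, by linarith⟩, hr a le_rfl (by linarith)⟩

lemma Sitin_eq_of_between (h : InducedExchange α a b U V) {d : ℝ} (ha : 0 < a)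
    (had : a < d) (hbd : b < d) (hd : d < a + b) :
    Sitin α d = {U, V, U ++ V} := by
  have h₁ : ∀ x, 0 ≤ x → x < d - b → itin α (Ico 0 d) x = U := fun x h0 hx =>
    ((h.left x h0 (by linarith)).mono hd.le).itin_eq ⟨by linarith, by linarith⟩
  have h₂ : ∀ x, d - b ≤ x → x < a → itin α (Ico 0 d) x = U ++ V := fun x h0 hx =>
    (h.left_right had.le hd.le (by linarith) h0 hx).itin_eq ⟨by linarith, by linarith⟩
  have h₃ : ∀ x, a ≤ x → x < d → itin α (Ico 0 d) x = V := fun x h0 hx =>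
    ((h.right x h0 (by linarith)).mono hd.le).itin_eq ⟨by linarith, by linarith⟩
  ext w
  simp only [Sitin, mem_ofPred_eq, mem_Ico, mem_insert_iff, mem_singleton_iff]
  constructor
  · rintro ⟨x, ⟨hx0, hx⟩, rfl⟩
    rcases lt_or_ge x (d - b) with hxb | hxb
    · exact .inl (h₁ x hx0 hxb)
    rcases lt_or_ge x a with hxa | hxa
    · exact .inr (.inr (h₂ x hxb hxa))
    · exact .inr (.inl (h₃ x hxa hx))
  · rintro (rfl | rfl | rfl)
    · exact ⟨0, ⟨le_rfl, by linarith⟩, h₁ 0 le_rfl (by linarith)⟩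
    · exact ⟨a, ⟨ha.le, had⟩, h₃ a le_rfl had⟩
    · exact ⟨d - b, ⟨by linarith, by linarith⟩, h₂ _ le_rfl (by linarith)⟩

end InducedExchange

lemma lex_of_append_lex {X Y Z : List Bool} (h : List.Lex (· < ·) (X ++ Y) Z) :
    List.Lex (· < ·) X Z := by
  induction X generalizing Z with
  | nil => cases Z <;> [cases h; exact .nil]
  | cons c X ih =>
    cases h with
    | cons h => exact .cons (ih h)
    | rel h => exact .rel h

lemma lex_append_of_length_le {X Y Z : List Bool} (h : List.Lex (· < ·) X Z)
    (hl : Z.length ≤ X.length) : List.Lex (· < ·) (X ++ Y) Z := by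
  induction h with
  | nil => simp at hl
  | cons _ ih => exact .cons (ih (by simpa using hl))
  | rel h => exact .rel h

/-- Subtractive Euclidean algorithm on a pair of reals. -/
noncomputable def euclidStep (p : ℝ × ℝ) : ℝ × ℝ :=
  if p.2 < p.1 then (p.1 - p.2, p.2) else (p.1, p.2 - p.1)

lemma euclidStep_swap {p : ℝ × ℝ} (h : p.1 ≠ p.2) :
    euclidStep p.swap = (euclidStep p).swap := by
  rcases lt_or_gt_of_ne h with h | h <;> simp [euclidStep, h, h.not_gt]

lemma euclidStep_add {p : ℝ × ℝ} : (euclidStep p).1 + (euclidStep p).2 = max p.1 p.2 := by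
  rcases lt_or_ge p.2 p.1 with h | h
  · simp [euclidStep, h, max_eq_left h.le]
  · simp [euclidStep, h.not_gt, max_eq_right h]

/-- The subtractive Euclidean algorithm started at `(α, 1 - α)`. -/
noncomputable def euclidSeq (α : ℝ) (n : ℕ) : ℝ × ℝ := euclidStep^[n] (α, 1 - α)

lemma euclidSeq_succ (α : ℝ) (n : ℕ) : euclidSeq α (n + 1) = euclidStep (euclidSeq α n) :=
  Function.iterate_succ_apply' ..

/-- The absolute value of `p_{k-1} - α q_{k-1}`, as a product of iterates of the Gauss map. -/
noncomputable def convergentError (α : ℝ) (k : ℕ) : ℝ := ∏ i ∈ Finset.range k, gaussMap^[i] α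

section ContinuedFraction

variable {α : ℝ}

lemma gaussMap_iterate_irrational (hirr : Irrational α) (k : ℕ) : Irrational (gaussMap^[k] α) := by
  induction k with
  | zero => exact hirr
  | succ k ih =>
    rw [Function.iterate_succ_apply', gaussMap, Int.fract]
    exact ih.inv.sub_intCast _

lemma gaussMap_iterate_pos (hα : α ∈ Ioo (0 : ℝ) 1) (hirr : Irrational α) (k : ℕ) :
    0 < gaussMap^[k] α := by
  refine lt_of_le_of_ne ?_ (gaussMap_iterate_irrational hirr k).ne_zero.symm
  cases k with
  | zero => exact hα.1.le
  | succ k =>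
    rw [Function.iterate_succ_apply']
    exact Int.fract_nonneg _

lemma gaussMap_iterate_lt_one (hα : α ∈ Ioo (0 : ℝ) 1) (k : ℕ) : gaussMap^[k] α < 1 := by
  cases k with
  | zero => exact hα.2
  | succ k =>
    rw [Function.iterate_succ_apply']
    exact Int.fract_lt_one _

lemma one_le_cfa (hα : α ∈ Ioo (0 : ℝ) 1) (hirr : Irrational α) (k : ℕ) :
    1 ≤ cfa α (k + 1) := by
  rw [cfa, Nat.add_sub_cancel, Nat.one_le_floor_iff]
  exact (one_le_inv₀ (gaussMap_iterate_pos hα hirr k)).2 (gaussMap_iterate_lt_one hα k).le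

lemma convergentError_pos (hα : α ∈ Ioo (0 : ℝ) 1) (hirr : Irrational α) (k : ℕ) :
    0 < convergentError α k :=
  Finset.prod_pos fun i _ => gaussMap_iterate_pos hα hirr i

lemma convergentError_succ_lt (hα : α ∈ Ioo (0 : ℝ) 1) (hirr : Irrational α) (k : ℕ) :
    convergentError α (k + 1) < convergentError α k := by
  rw [convergentError, Finset.prod_range_succ]
  exact mul_lt_of_lt_one_right (convergentError_pos hα hirr k) (gaussMap_iterate_lt_one hα k)

lemma convergentError_add_two (hα : α ∈ Ioo (0 : ℝ) 1) (hirr : Irrational α) (k : ℕ) :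
    convergentError α (k + 2) =
      convergentError α k - cfa α (k + 1) * convergentError α (k + 1) := by
  have hg := gaussMap_iterate_pos hα hirr k
  have hs : gaussMap^[k + 1] α = (gaussMap^[k] α)⁻¹ - cfa α (k + 1) := by
    rw [Function.iterate_succ_apply', gaussMap, Int.fract, cfa, Nat.add_sub_cancel,
      natCast_floor_eq_intCast_floor (inv_pos.2 hg).le]
  rw [convergentError, Finset.prod_range_succ, hs, Finset.prod_range_succ]
  simp only [convergentError, Finset.prod_range_succ]
  field_simp

lemma cfPQ_sub (hα : α ∈ Ioo (0 : ℝ) 1) (hirr : Irrational α) (k : ℕ) :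
    ((cfPQ α k).1 : ℝ) - α * ((cfPQ α k).2 : ℝ) = (-1) ^ k * convergentError α k := by
  induction k using Nat.twoStepInduction with
  | zero => simp [cfPQ, convergentError]
  | one => simp [cfPQ, convergentError]
  | more k h₀ h₁ =>
    rw [convergentError_add_two hα hirr, cfPQ]
    push_cast
    linear_combination h₀ + (cfa α (k + 1) : ℝ) * h₁

lemma sub_mul_convergentError_pos (hα : α ∈ Ioo (0 : ℝ) 1) (hirr : Irrational α) {k s : ℕ}
    (hs : s ≤ cfa α (k + 1)) : 0 < convergentError α k - s * convergentError α (k + 1) := by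
  have h := convergentError_add_two hα hirr k
  have h₁ := convergentError_pos hα hirr (k + 1)
  have h₂ := convergentError_pos hα hirr (k + 2)
  have hs' : (s : ℝ) ≤ cfa α (k + 1) := by exact_mod_cast hs
  nlinarith

lemma cfDelta_eq (hα : α ∈ Ioo (0 : ℝ) 1) (hirr : Irrational α) {k s : ℕ}
    (hs : s ≤ cfa α (k + 1)) :
    cfDelta α k s =
      convergentError α (k + 1) + (convergentError α k - s * convergentError α (k + 1)) := by
  have hpos := sub_mul_convergentError_pos hα hirr hs
  have h₁ := convergentError_pos hα hirr (k + 1)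
  rw [cfDelta, cfPQ_sub hα hirr, cfPQ_sub hα hirr, ← abs_of_pos (add_pos h₁ hpos),
    show ((s : ℝ) - 1) * ((-1) ^ (k + 1) * convergentError α (k + 1)) +
      (-1) ^ k * convergentError α k = (-1) ^ k * (convergentError α (k + 1) +
        (convergentError α k - s * convergentError α (k + 1))) by ring,
    abs_mul, abs_pow, abs_neg, abs_one, one_pow, one_mul]

/-- The pair exchanged by the map induced on `[0, δ_{k,s})`, up to order. -/
noncomputable def cfPair (α : ℝ) (k s : ℕ) : ℝ × ℝ :=
  (convergentError α (k + 1), convergentError α k - s * convergentError α (k + 1))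

lemma cfPair_fst_lt_snd (hα : α ∈ Ioo (0 : ℝ) 1) (hirr : Irrational α) {k s : ℕ}
    (hs : s < cfa α (k + 1)) : (cfPair α k s).1 < (cfPair α k s).2 := by
  have := sub_mul_convergentError_pos hα hirr (Nat.succ_le_of_lt hs)
  push_cast at this
  simp only [cfPair]
  linarith

lemma cfPair_snd_lt_fst (hα : α ∈ Ioo (0 : ℝ) 1) (hirr : Irrational α) (k : ℕ) :
    (cfPair α k (cfa α (k + 1))).2 < (cfPair α k (cfa α (k + 1))).1 := by
  simp only [cfPair, ← convergentError_add_two hα hirr]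
  exact convergentError_succ_lt hα hirr (k + 1)

lemma cfPair_fst_ne_snd (hα : α ∈ Ioo (0 : ℝ) 1) (hirr : Irrational α) {k s : ℕ}
    (hs : s ≤ cfa α (k + 1)) : (cfPair α k s).1 ≠ (cfPair α k s).2 := by
  rcases hs.lt_or_eq with h | rfl
  · exact (cfPair_fst_lt_snd hα hirr h).ne
  · exact (cfPair_snd_lt_fst hα hirr k).ne'

lemma euclidStep_cfPair_of_lt (hα : α ∈ Ioo (0 : ℝ) 1) (hirr : Irrational α) {k s : ℕ}
    (hs : s < cfa α (k + 1)) : euclidStep (cfPair α k s) = cfPair α k (s + 1) := by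
  rw [euclidStep, if_neg (cfPair_fst_lt_snd hα hirr hs).not_gt]
  simp only [cfPair, Prod.mk.injEq, true_and]
  push_cast
  ring

lemma euclidStep_cfPair_cfa (hα : α ∈ Ioo (0 : ℝ) 1) (hirr : Irrational α) (k : ℕ) :
    euclidStep (cfPair α k (cfa α (k + 1))) = (cfPair α (k + 1) 1).swap := by
  rw [euclidStep, if_pos (cfPair_snd_lt_fst hα hirr k)]
  simp [cfPair, ← convergentError_add_two hα hirr]

lemma euclidSeq_succ_eq_or_swap {n k s : ℕ} {q : ℝ × ℝ} (hne : (cfPair α k s).1 ≠ (cfPair α k s).2)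
    (h : euclidSeq α n = cfPair α k s ∨ euclidSeq α n = (cfPair α k s).swap)
    (hq : euclidStep (cfPair α k s) = q ∨ euclidStep (cfPair α k s) = q.swap) :
    euclidSeq α (n + 1) = q ∨ euclidSeq α (n + 1) = q.swap := by
  rw [euclidSeq_succ]
  rcases h with h | h
  · rwa [h]
  · rw [h, euclidStep_swap hne]
    rcases hq with hq | hq <;> simp [hq]

lemma euclidSeq_zero_eq : euclidSeq α 0 = cfPair α 0 1 := by
  simp [euclidSeq, cfPair, convergentError]

lemma exists_cfPair_of_euclidSeq (hα : α ∈ Ioo (0 : ℝ) 1) (hirr : Irrational α) (n : ℕ) :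
    ∃ k s, 1 ≤ s ∧ s ≤ cfa α (k + 1) ∧
      (euclidSeq α n = cfPair α k s ∨ euclidSeq α n = (cfPair α k s).swap) := by
  induction n with
  | zero => exact ⟨0, 1, le_rfl, one_le_cfa hα hirr 0, .inl euclidSeq_zero_eq⟩
  | succ n ih =>
    obtain ⟨k, s, h1, hs, h⟩ := ih
    have hne := cfPair_fst_ne_snd hα hirr hs
    rcases hs.lt_or_eq with hs | rfl
    · exact ⟨k, s + 1, by omega, hs, euclidSeq_succ_eq_or_swap hne h
        (.inl (euclidStep_cfPair_of_lt hα hirr hs))⟩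
    · exact ⟨k + 1, 1, le_rfl, one_le_cfa hα hirr _, euclidSeq_succ_eq_or_swap hne h
        (.inr (euclidStep_cfPair_cfa hα hirr k))⟩

lemma exists_euclidSeq_of_cfPair (hα : α ∈ Ioo (0 : ℝ) 1) (hirr : Irrational α) (k s : ℕ)
    (h1 : 1 ≤ s) (hs : s ≤ cfa α (k + 1)) :
    ∃ n, euclidSeq α n = cfPair α k s ∨ euclidSeq α n = (cfPair α k s).swap := by
  induction k generalizing s with
  | zero =>
    induction s, h1 using Nat.le_induction with
    | base => exact ⟨0, .inl euclidSeq_zero_eq⟩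
    | succ s h1 ih =>
      obtain ⟨n, h⟩ := ih (by omega)
      exact ⟨n + 1, euclidSeq_succ_eq_or_swap (cfPair_fst_ne_snd hα hirr (by omega)) h
        (.inl (euclidStep_cfPair_of_lt hα hirr hs))⟩
  | succ k ihk =>
    induction s, h1 using Nat.le_induction with
    | base =>
      obtain ⟨n, h⟩ := ihk _ (one_le_cfa hα hirr k) le_rfl
      exact ⟨n + 1, euclidSeq_succ_eq_or_swap (cfPair_fst_ne_snd hα hirr le_rfl) h
        (.inr (euclidStep_cfPair_cfa hα hirr k))⟩
    | succ s h1 ih =>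
      obtain ⟨n, h⟩ := ih (by omega)
      exact ⟨n + 1, euclidSeq_succ_eq_or_swap (cfPair_fst_ne_snd hα hirr (by omega)) h
        (.inl (euclidStep_cfPair_of_lt hα hirr hs))⟩

lemma euclidSeq_pos_ne (hα : α ∈ Ioo (0 : ℝ) 1) (hirr : Irrational α) (n : ℕ) :
    0 < (euclidSeq α n).1 ∧ 0 < (euclidSeq α n).2 ∧ (euclidSeq α n).1 ≠ (euclidSeq α n).2 := by
  obtain ⟨k, s, -, hs, h⟩ := exists_cfPair_of_euclidSeq hα hirr n
  have h₁ : 0 < (cfPair α k s).1 := convergentError_pos hα hirr (k + 1)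
  have h₂ : 0 < (cfPair α k s).2 := sub_mul_convergentError_pos hα hirr hs
  have hne := cfPair_fst_ne_snd hα hirr hs
  rcases h with h | h <;> rw [h]
  · exact ⟨h₁, h₂, hne⟩
  · exact ⟨h₂, h₁, hne.symm⟩

/-- The values `δ_{k,s}` are the sums of the pairs met by the subtractive Euclidean algorithm. -/
lemma setOf_cfDelta_eq_range (hα : α ∈ Ioo (0 : ℝ) 1) (hirr : Irrational α) :
    {d : ℝ | ∃ k s : ℕ, 1 ≤ s ∧ s ≤ cfa α (k + 1) ∧ d = cfDelta α k s} =
      range fun n => (euclidSeq α n).1 + (euclidSeq α n).2 := by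
  have key : ∀ n k s, s ≤ cfa α (k + 1) →
      (euclidSeq α n = cfPair α k s ∨ euclidSeq α n = (cfPair α k s).swap) →
      (euclidSeq α n).1 + (euclidSeq α n).2 = cfDelta α k s := by
    rintro n k s hs (h | h) <;> rw [h, cfDelta_eq hα hirr hs]
    · rfl
    · exact add_comm _ _
  ext d
  constructor
  · rintro ⟨k, s, h1, hs, rfl⟩
    obtain ⟨n, h⟩ := exists_euclidSeq_of_cfPair hα hirr k s h1 hs
    exact ⟨n, key n k s hs h⟩
  · rintro ⟨n, rfl⟩
    obtain ⟨k, s, h1, hs, h⟩ := exists_cfPair_of_euclidSeq hα hirr n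
    exact ⟨k, s, h1, hs, key n k s hs h⟩

lemma euclidSeq_add_strictAnti (hα : α ∈ Ioo (0 : ℝ) 1) (hirr : Irrational α) :
    StrictAnti fun n => (euclidSeq α n).1 + (euclidSeq α n).2 := by
  refine strictAnti_nat_of_succ_lt fun n => ?_
  obtain ⟨h₁, h₂, -⟩ := euclidSeq_pos_ne hα hirr n
  rw [euclidSeq_succ, euclidStep_add, max_lt_iff]
  constructor <;> linarith

lemma exists_inducedExchange (hα : α ∈ Ioo (0 : ℝ) 1) (hirr : Irrational α) (n : ℕ) :
    ∃ U V, InducedExchange α (euclidSeq α n).1 (euclidSeq α n).2 U V ∧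
      List.Lex (· < ·) (U ++ V) V := by
  induction n with
  | zero => exact ⟨[false], [true], inducedExchange_initial, .rel (by decide)⟩
  | succ n ih =>
    obtain ⟨U, V, hE, hlex⟩ := ih
    obtain ⟨h₁, h₂, hne⟩ := euclidSeq_pos_ne hα hirr n
    rw [euclidSeq_succ, euclidStep]
    rcases lt_or_gt_of_ne hne with h | h
    · rw [if_neg h.not_gt]
      exact ⟨_, _, hE.step_of_gt h₁ h, lex_append_of_length_le hlex (by simp)⟩
    · rw [if_pos h]
      exact ⟨_, _, hE.step_of_lt h₂ h, List.Lex.append_left _ hlex U⟩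

end ContinuedFraction

lemma eq_and_eq_of_pair_eq_of_lt {β : Type*} [Preorder β] {a b c d : β} (hab : a < b) (hcd : c < d)
    (h : ({a, b} : Set β) = {c, d}) : a = c ∧ b = d := by
  rcases pair_eq_pair_iff.1 h with h | ⟨rfl, rfl⟩
  · exact h
  · exact absurd hab hcd.asymm

/-- if `δ̃ < δ` are consecutive elements of
`Δ = {δ_{k,s} : k ≥ 0, 1 ≤ s ≤ a_{k+1}}` and `S_δ = {R, R'}` with `R ≺_lex R'`,
then `S_β = {R, R', RR'}` for all `δ̃ < β < δ`, and `S_δ̃` is `{R, RR'}` or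
`{R', RR'}`. -/
theorem Sitin_between_consecutive_deltas (α : ℝ) (hα : α ∈ Set.Ioo (0:ℝ) 1)
    (hirr : Irrational α) (dlt' dlt : ℝ)
    (hd' : dlt' ∈ {d : ℝ | ∃ k s : ℕ, 1 ≤ s ∧ s ≤ cfa α (k + 1) ∧ d = cfDelta α k s})
    (hd : dlt ∈ {d : ℝ | ∃ k s : ℕ, 1 ≤ s ∧ s ≤ cfa α (k + 1) ∧ d = cfDelta α k s})
    (hlt : dlt' < dlt)
    (hconsec : ∀ d ∈
      {d : ℝ | ∃ k s : ℕ, 1 ≤ s ∧ s ≤ cfa α (k + 1) ∧ d = cfDelta α k s},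
      ¬(dlt' < d ∧ d < dlt))
    (R R' : List Bool) (hlex : List.Lex (· < ·) R R')
    (hS : Sitin α dlt = ({R, R'} : Set (List Bool))) :
    (∀ β : ℝ, dlt' < β → β < dlt →
      Sitin α β = ({R, R', R ++ R'} : Set (List Bool))) ∧
    (Sitin α dlt' = ({R, R ++ R'} : Set (List Bool)) ∨
      Sitin α dlt' = ({R', R ++ R'} : Set (List Bool))) := by
  rw [setOf_cfDelta_eq_range hα hirr] at hd hd' hconsec
  have hanti := euclidSeq_add_strictAnti hα hirr
  obtain ⟨n, rfl⟩ := hd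
  obtain ⟨m, rfl⟩ := hd'
  have hnm : n < m := hanti.lt_iff_gt.1 hlt
  obtain rfl : m = n + 1 := by
    by_contra hne
    exact hconsec _ ⟨n + 1, rfl⟩ ⟨hanti (by omega), hanti (by omega)⟩
  obtain ⟨U, V, hE, hUV⟩ := exists_inducedExchange hα hirr n
  obtain ⟨h₁, h₂, hne⟩ := euclidSeq_pos_ne hα hirr n
  obtain ⟨h₁', h₂', -⟩ := euclidSeq_pos_ne hα hirr (n + 1)
  obtain ⟨rfl, rfl⟩ : R = U ∧ R' = V :=
    eq_and_eq_of_pair_eq_of_lt hlex (lex_of_append_lex hUV)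
      (hS.symm.trans (hE.Sitin_eq h₁ h₂))
  simp only [euclidSeq_succ] at h₁' h₂' ⊢
  refine ⟨fun β hβ hβ' => ?_, ?_⟩
  · rw [euclidStep_add, max_lt_iff] at hβ
    exact hE.Sitin_eq_of_between h₁ hβ.1 hβ.2 hβ'
  · rw [euclidStep] at h₁' h₂' ⊢
    rcases lt_or_gt_of_ne hne with h | h
    · rw [if_neg h.not_gt] at h₁' h₂' ⊢
      right
      rw [pair_comm]
      exact (hE.step_of_gt h₁ h).Sitin_eq h₁' h₂'
    · rw [if_pos h] at h₁' h₂' ⊢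
      left
      exact (hE.step_of_lt h₂ h).Sitin_eq h₁' h₂'
end
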